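/- Let A be a weak Hopf algebra over a field K, let l be a nondegenerate left integral in A, and let λ ∈ A* be its dual left integral, i.e. the unique functional with Σ l₍₁₎ λ(l₍₂₎) = 1. Then S(l) = l if and only if λ is a q-trace, i.e. λ(xy) = λ(y S(S(x))) for all x, y ∈ A. -/

import Mathlib

open TensorProduct

noncomputable section

variable (K : Type*) [Field K] (A : Type*) [Ring A] [Algebra K A]

/-- `Π^L(x) = Σ ε(1₍₁₎ x) 1₍₂₎`. -/
def piL (Δ : A →ₗ[K] A ⊗[K] A) (ε : A →ₗ[K] K) : A →ₗ[K] A :=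
  (TensorProduct.lid K A).toLinearMap ∘ₗ ε.rTensor A ∘ₗ
    LinearMap.mulLeft K (Δ 1) ∘ₗ (TensorProduct.mk K A A).flip 1

/-- `Π^R(x) = Σ 1₍₁₎ ε(x 1₍₂₎)`. -/
def piR (Δ : A →ₗ[K] A ⊗[K] A) (ε : A →ₗ[K] K) : A →ₗ[K] A :=
  (TensorProduct.rid K A).toLinearMap ∘ₗ ε.lTensor A ∘ₗ
    LinearMap.mulRight K (Δ 1) ∘ₗ TensorProduct.mk K A A 1

/-- A weak bialgebra structure on the `K`-algebra `A`, with comultiplication `Δ`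
and counit `ε`. -/
structure WeakBialgebra (Δ : A →ₗ[K] A ⊗[K] A) (ε : A →ₗ[K] K) : Prop where
  coassoc : ∀ x : A,
    (TensorProduct.assoc K A A A) (Δ.rTensor A (Δ x)) = Δ.lTensor A (Δ x)
  counit_left : ∀ x : A, (TensorProduct.lid K A) (ε.rTensor A (Δ x)) = x
  counit_right : ∀ x : A, (TensorProduct.rid K A) (ε.lTensor A (Δ x)) = x
  comul_mul : ∀ x y : A, Δ (x * y) = Δ x * Δ y
  weak_counit_a : ∀ x y z : A,
    ε (x * y * z) =
      LinearMap.mul' K K (TensorProduct.map (ε ∘ₗ LinearMap.mulLeft K x)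
        (ε ∘ₗ LinearMap.mulRight K z) (Δ y))
  weak_counit_b : ∀ x y z : A,
    ε (x * y * z) =
      LinearMap.mul' K K (TensorProduct.map (ε ∘ₗ LinearMap.mulRight K z)
        (ε ∘ₗ LinearMap.mulLeft K x) (Δ y))
  weak_comul_unit_a :
    Δ.rTensor A (Δ 1) =
      (Δ 1 ⊗ₜ[K] (1 : A)) * ((TensorProduct.assoc K A A A).symm ((1 : A) ⊗ₜ[K] Δ 1))
  weak_comul_unit_b :
    Δ.rTensor A (Δ 1) =
      ((TensorProduct.assoc K A A A).symm ((1 : A) ⊗ₜ[K] Δ 1)) * (Δ 1 ⊗ₜ[K] (1 : A))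

/-- A weak Hopf algebra structure: a weak bialgebra together with an antipode `S`. -/
structure WeakHopfAlgebra (Δ : A →ₗ[K] A ⊗[K] A) (ε : A →ₗ[K] K) (S : A →ₗ[K] A) : Prop where
  toWeakBialgebra : WeakBialgebra K A Δ ε
  antipode_a : ∀ x : A,
    LinearMap.mul' K A (LinearMap.lTensor A S (Δ x)) = piL K A Δ ε x
  antipode_b : ∀ x : A,
    LinearMap.mul' K A (LinearMap.rTensor A S (Δ x)) = piR K A Δ ε x
  antipode_c : ∀ x : A,
    LinearMap.mul' K A (TensorProduct.map S (LinearMap.mul' K A ∘ₗ LinearMap.lTensor A S)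
      (LinearMap.lTensor A Δ (Δ x))) = S x

section WeakHopf

variable {K A}

/-- `Σ φ(t₍₁₎) t₍₂₎`. -/
def sliceL {M : Type*} [AddCommGroup M] [Module K M] (φ : A →ₗ[K] K) : A ⊗[K] M →ₗ[K] M :=
  (TensorProduct.lid K M).toLinearMap ∘ₗ φ.rTensor M

/-- `Σ t₍₁₎ φ(t₍₂₎)`. -/
def sliceR {M : Type*} [AddCommGroup M] [Module K M] (φ : A →ₗ[K] K) : M ⊗[K] A →ₗ[K] M :=
  (TensorProduct.rid K M).toLinearMap ∘ₗ φ.lTensor M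

section Slice

variable {M N : Type*} [AddCommGroup M] [Module K M] [AddCommGroup N] [Module K N]

@[simp]
theorem sliceL_tmul (φ : A →ₗ[K] K) (a : A) (m : M) : sliceL φ (a ⊗ₜ[K] m) = φ a • m := by
  simp [sliceL]

@[simp]
theorem sliceR_tmul (φ : A →ₗ[K] K) (m : M) (a : A) : sliceR φ (m ⊗ₜ[K] a) = φ a • m := by
  simp [sliceR]

theorem map_sliceL (f : M →ₗ[K] N) (φ : A →ₗ[K] K) (t : A ⊗[K] M) :
    f (sliceL φ t) = sliceL φ (f.lTensor A t) := by
  induction t with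
  | zero => simp
  | tmul a m => simp
  | add s t hs ht => simp only [map_add, hs, ht]

theorem map_sliceR (f : M →ₗ[K] N) (φ : A →ₗ[K] K) (t : M ⊗[K] A) :
    f (sliceR φ t) = sliceR φ (f.rTensor A t) := by
  induction t with
  | zero => simp
  | tmul a m => simp
  | add s t hs ht => simp only [map_add, hs, ht]

theorem apply_sliceL_eq_apply_sliceR (φ ψ : A →ₗ[K] K) (t : A ⊗[K] A) :
    φ (sliceL ψ t) = ψ (sliceR φ t) := by
  induction t with
  | zero => simp
  | tmul a m => simp [mul_comm]
  | add s t hs ht => simp only [map_add, hs, ht]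

theorem sliceR_comp_mulLeft (φ : A →ₗ[K] K) (x : A) (t : A ⊗[K] A) :
    sliceR (φ ∘ₗ LinearMap.mulLeft K x) t = sliceR φ (((1 : A) ⊗ₜ[K] x) * t) := by
  induction t with
  | zero => simp
  | tmul a m => simp
  | add s t hs ht => simp only [map_add, hs, ht, mul_add]

theorem sliceR_tmul_one_mul (φ : A →ₗ[K] K) (x : A) (t : A ⊗[K] A) :
    sliceR φ ((x ⊗ₜ[K] (1 : A)) * t) = x * sliceR φ t := by
  induction t with
  | zero => simp
  | tmul a m => simp
  | add s t hs ht => simp only [map_add, hs, ht, mul_add]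

theorem sliceL_comp_mulRight (φ : A →ₗ[K] K) (x : A) (t : A ⊗[K] A) :
    sliceL (φ ∘ₗ LinearMap.mulRight K x) t = sliceL φ (t * (x ⊗ₜ[K] (1 : A))) := by
  induction t with
  | zero => simp
  | tmul a m => simp
  | add s t hs ht => simp only [map_add, hs, ht, add_mul]

theorem lTensor_mulLeft (x : A) (t : A ⊗[K] A) :
    (LinearMap.mulLeft K x).lTensor A t = ((1 : A) ⊗ₜ[K] x) * t := by
  induction t with
  | zero => simp
  | tmul a m => simp
  | add s t hs ht => simp only [map_add, hs, ht, mul_add]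

theorem assoc_assoc_symm_mul (s t : A ⊗[K] A) :
    TensorProduct.assoc K A A A
        ((TensorProduct.assoc K A A A).symm ((1 : A) ⊗ₜ[K] s) * (t ⊗ₜ[K] (1 : A))) =
      (LinearMap.mulLeft K s ∘ₗ (TensorProduct.mk K A A).flip 1).lTensor A t := by
  induction t with
  | zero => simp
  | tmul p q =>
    induction s with
    | zero => simp
    | tmul a b => simp
    | add s s' hs hs' =>
      simp only [tmul_add, map_add, add_mul, hs, hs']
      simp [add_mul, tmul_add]
  | add t t' ht ht' => simp only [add_tmul, mul_add, map_add, ht, ht']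

theorem assoc_mul_assoc_symm (s t : A ⊗[K] A) :
    TensorProduct.assoc K A A A
        ((t ⊗ₜ[K] (1 : A)) * (TensorProduct.assoc K A A A).symm ((1 : A) ⊗ₜ[K] s)) =
      (LinearMap.mulRight K s ∘ₗ (TensorProduct.mk K A A).flip 1).lTensor A t := by
  induction t with
  | zero => simp
  | tmul p q =>
    induction s with
    | zero => simp
    | tmul a b => simp
    | add s s' hs hs' =>
      simp only [tmul_add, map_add, mul_add, hs, hs']
      simp [mul_add, tmul_add]
  | add t t' ht ht' => simp only [add_tmul, add_mul, map_add, ht, ht']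

theorem assoc_symm_mul (s t : A ⊗[K] A) :
    (TensorProduct.assoc K A A A).symm ((1 : A) ⊗ₜ[K] s) * (t ⊗ₜ[K] (1 : A)) =
      (LinearMap.mulRight K t ∘ₗ TensorProduct.mk K A A 1).rTensor A s := by
  induction s with
  | zero => simp
  | tmul p q =>
    induction t with
    | zero => simp
    | tmul a b => simp
    | add s s' hs hs' =>
      simp only [add_tmul, mul_add, hs, hs']
      simp [mul_add, add_tmul]
  | add t t' ht ht' => simp only [tmul_add, add_mul, map_add, ht, ht']

end Slice

namespace WeakBialgebra

variable {Δ : A →ₗ[K] A ⊗[K] A} {ε : A →ₗ[K] K}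

theorem piL_apply (x : A) : piL K A Δ ε x = sliceL ε (Δ 1 * (x ⊗ₜ[K] (1 : A))) := by
  simp [piL, sliceL]

theorem piR_apply (x : A) : piR K A Δ ε x = sliceR ε (((1 : A) ⊗ₜ[K] x) * Δ 1) := by
  simp [piR, sliceR]

theorem comul_one_mul (h : WeakBialgebra K A Δ ε) (x : A) : Δ 1 * Δ x = Δ x := by rw [← h.comul_mul, one_mul]

theorem comul_mul_one (h : WeakBialgebra K A Δ ε) (x : A) : Δ x * Δ 1 = Δ x := by rw [← h.comul_mul, mul_one]

theorem sliceL_counit (h : WeakBialgebra K A Δ ε) (x : A) : sliceL ε (Δ x) = x := h.counit_left x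

theorem sliceR_counit (h : WeakBialgebra K A Δ ε) (x : A) : sliceR ε (Δ x) = x := h.counit_right x

theorem lTensor_comul_one_left (h : WeakBialgebra K A Δ ε) :
    Δ.lTensor A (Δ 1) =
      (LinearMap.mulLeft K (Δ 1) ∘ₗ (TensorProduct.mk K A A).flip 1).lTensor A (Δ 1) := by
  rw [← h.coassoc, h.weak_comul_unit_b, assoc_assoc_symm_mul]

theorem lTensor_comul_one_right (h : WeakBialgebra K A Δ ε) :
    Δ.lTensor A (Δ 1) =
      (LinearMap.mulRight K (Δ 1) ∘ₗ (TensorProduct.mk K A A).flip 1).lTensor A (Δ 1) := by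
  rw [← h.coassoc, h.weak_comul_unit_a, assoc_mul_assoc_symm]

theorem comul_piL_left (h : WeakBialgebra K A Δ ε) (x : A) :
    Δ (piL K A Δ ε x) = Δ 1 * (piL K A Δ ε x ⊗ₜ[K] (1 : A)) := by
  rw [piL_apply, ← sliceL_comp_mulRight, map_sliceL, h.lTensor_comul_one_left, ← map_sliceL]
  simp

theorem comul_piL_right (h : WeakBialgebra K A Δ ε) (x : A) :
    Δ (piL K A Δ ε x) = (piL K A Δ ε x ⊗ₜ[K] (1 : A)) * Δ 1 := by
  rw [piL_apply, ← sliceL_comp_mulRight, map_sliceL, h.lTensor_comul_one_right, ← map_sliceL]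
  simp

theorem comul_piR (h : WeakBialgebra K A Δ ε) (x : A) :
    Δ (piR K A Δ ε x) = ((1 : A) ⊗ₜ[K] piR K A Δ ε x) * Δ 1 := by
  rw [piR_apply, ← sliceR_comp_mulLeft, map_sliceR, h.weak_comul_unit_b, assoc_symm_mul,
    ← map_sliceR]
  simp

theorem lTensor_piL_comul_one (h : WeakBialgebra K A Δ ε) : (piL K A Δ ε).lTensor A (Δ 1) = Δ 1 := by
  have hp : piL K A Δ ε =
      sliceL ε ∘ₗ (LinearMap.mulLeft K (Δ 1) ∘ₗ (TensorProduct.mk K A A).flip 1) := by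
    ext x
    simp [piL_apply]
  have hid : sliceL ε ∘ₗ Δ = LinearMap.id := by
    ext x
    simp [h.sliceL_counit]
  rw [hp, LinearMap.lTensor_comp, LinearMap.comp_apply, ← h.lTensor_comul_one_left,
    ← LinearMap.comp_apply, ← LinearMap.lTensor_comp, hid]
  simp

theorem rTensor_piR_comul (h : WeakBialgebra K A Δ ε) (x : A) :
    (piR K A Δ ε).rTensor A (Δ x) = ((1 : A) ⊗ₜ[K] x) * Δ 1 := by
  have key : ∀ u t : A ⊗[K] A,
      (sliceL ε ∘ₗ LinearMap.mulLeft K u ∘ₗ (TensorProduct.mk K A A).flip 1).lTensor A t =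
        (sliceR ε ∘ₗ LinearMap.mulRight K t ∘ₗ TensorProduct.mk K A A 1).rTensor A u := by
    intro u t
    induction u with
    | zero =>
      rw [map_zero, LinearMap.mulLeft_zero_eq_zero]
      simp
    | tmul a b =>
      induction t with
      | zero => simp
      | tmul p q => simp [smul_tmul']
      | add t t' ht ht' =>
        rw [map_add, ht, ht']
        simp [mul_add, add_tmul]
    | add u u' hu hu' =>
      rw [map_add, ← hu, ← hu', ← LinearMap.add_apply, ← LinearMap.lTensor_add]
      congr 2
      ext
      simp [add_mul]
  have hR : piR K A Δ ε =
      sliceR ε ∘ₗ LinearMap.mulRight K (Δ 1) ∘ₗ TensorProduct.mk K A A 1 := by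
    ext x
    simp [piR_apply]
  have h1 : sliceL ε ∘ₗ LinearMap.mulLeft K (Δ x) ∘ₗ (TensorProduct.mk K A A).flip 1 =
      (sliceL ε ∘ₗ LinearMap.mulLeft K (Δ x)) ∘ₗ
        (LinearMap.mulLeft K (Δ 1) ∘ₗ (TensorProduct.mk K A A).flip 1) := by
    ext y
    simp [← mul_assoc, h.comul_mul_one]
  have h2 : (sliceL ε ∘ₗ LinearMap.mulLeft K (Δ x)) ∘ₗ Δ = LinearMap.mulLeft K x := by
    ext y
    simp [← h.comul_mul, h.sliceL_counit]
  rw [hR, ← key, h1, LinearMap.lTensor_comp, LinearMap.comp_apply, ← h.lTensor_comul_one_left,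
    ← LinearMap.comp_apply, ← LinearMap.lTensor_comp, h2, lTensor_mulLeft]

theorem rTensor_piR_comul_one (h : WeakBialgebra K A Δ ε) : (piR K A Δ ε).rTensor A (Δ 1) = Δ 1 := by
  rw [h.rTensor_piR_comul, ← Algebra.TensorProduct.one_def, one_mul]

theorem piR_one (h : WeakBialgebra K A Δ ε) : piR K A Δ ε 1 = 1 := by
  rw [piR_apply, ← Algebra.TensorProduct.one_def, one_mul, h.sliceR_counit]

theorem piL_one (h : WeakBialgebra K A Δ ε) : piL K A Δ ε 1 = 1 := by
  rw [piL_apply, ← Algebra.TensorProduct.one_def, mul_one, h.sliceL_counit]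

theorem piL_eq_sliceR (h : WeakBialgebra K A Δ ε) (q : A) :
    piL K A Δ ε q =
      sliceR (ε ∘ₗ LinearMap.mulRight K q) ((piL K A Δ ε).rTensor A (Δ 1)) := by
  have key : ∀ s t : A ⊗[K] A,
      sliceL ((LinearMap.mul' K K) ∘ₗ (TensorProduct.map ε (ε ∘ₗ LinearMap.mulRight K q)) ∘ₗ
        LinearMap.mulRight K t ∘ₗ (TensorProduct.mk K A A).flip 1) s =
      sliceR (ε ∘ₗ LinearMap.mulRight K q)
        ((sliceL ε ∘ₗ LinearMap.mulLeft K s ∘ₗ (TensorProduct.mk K A A).flip 1).rTensor A t) := by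
    intro s t
    induction s with
    | zero =>
      rw [map_zero, LinearMap.mulLeft_zero_eq_zero]
      simp
    | tmul p r =>
      induction t with
      | zero => simp
      | tmul a b => simp [smul_smul, mul_comm]
      | add t t' ht ht' =>
        simp only [map_add, ← ht, ← ht', sliceL_tmul, ← add_smul]
        simp [mul_add]
    | add s s' hs hs' =>
      rw [map_add, hs, hs', ← map_add, ← LinearMap.add_apply, ← LinearMap.rTensor_add]
      congr 3
      ext
      simp [add_mul]
  have hL : piL K A Δ ε =
      sliceL ε ∘ₗ LinearMap.mulLeft K (Δ 1) ∘ₗ (TensorProduct.mk K A A).flip 1 := by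
    ext x
    simp [piL_apply]
  have hc : ε ∘ₗ LinearMap.mulRight K q =
      (LinearMap.mul' K K) ∘ₗ (TensorProduct.map ε (ε ∘ₗ LinearMap.mulRight K q)) ∘ₗ
        LinearMap.mulRight K (Δ 1) ∘ₗ (TensorProduct.mk K A A).flip 1 := by
    have hmap : ∀ (p : A) (t : A ⊗[K] A),
        TensorProduct.map (ε ∘ₗ LinearMap.mulLeft K p) (ε ∘ₗ LinearMap.mulRight K q) t =
        TensorProduct.map ε (ε ∘ₗ LinearMap.mulRight K q) ((p ⊗ₜ[K] (1 : A)) * t) := by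
      intro p t
      induction t with
      | zero => simp
      | tmul a b => simp
      | add t t' ht ht' => simp only [map_add, mul_add, ht, ht']
    ext p
    have := h.weak_counit_a p 1 q
    rw [mul_one, hmap] at this
    simpa using this
  rw [hL, ← key, ← hc, sliceL_comp_mulRight]
  simp

theorem map_piR_piL_comm_comul_one (h : WeakBialgebra K A Δ ε) :
    TensorProduct.map (piR K A Δ ε) (piL K A Δ ε) (TensorProduct.comm K A A (Δ 1)) = Δ 1 := by
  have key : ∀ u t : A ⊗[K] A, ∀ f : A →ₗ[K] A,
      (∀ q, f q = sliceR (ε ∘ₗ LinearMap.mulRight K q) u) →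
      f.lTensor A t =
        (sliceR ε ∘ₗ LinearMap.mulRight K t ∘ₗ TensorProduct.mk K A A 1).rTensor A
          (TensorProduct.comm K A A u) := by
    intro u t f hf
    induction t with
    | zero => simp
    | tmul p q =>
      rw [LinearMap.lTensor_tmul, hf]
      clear hf
      induction u with
      | zero => simp
      | tmul c d => simp [smul_tmul]
      | add u u' hu hu' => simp only [map_add, tmul_add, hu, hu']
    | add t t' ht ht' =>
      rw [map_add, ht, ht', ← LinearMap.add_apply, ← LinearMap.rTensor_add]
      congr 2
      ext
      simp [mul_add]
  have hR : piR K A Δ ε =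
      sliceR ε ∘ₗ LinearMap.mulRight K (Δ 1) ∘ₗ TensorProduct.mk K A A 1 := by
    ext x
    simp [piR_apply]
  have hk := key _ (Δ 1) (piL K A Δ ε) h.piL_eq_sliceR
  rw [h.lTensor_piL_comul_one, ← hR] at hk
  conv_rhs => rw [hk]
  generalize Δ 1 = t
  induction t with
  | zero => simp
  | tmul a b => simp
  | add t t' ht ht' => simp only [map_add, ht, ht']

end WeakBialgebra

theorem lTensor_sliceR_assoc (φ : A →ₗ[K] K) (t : (A ⊗[K] A) ⊗[K] A) :
    (sliceR φ).lTensor A (TensorProduct.assoc K A A A t) = sliceR φ t := by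
  induction t with
  | zero => simp
  | tmul v c =>
    induction v with
    | zero => simp
    | tmul a b => simp
    | add v v' hv hv' =>
      rw [add_tmul, map_add, map_add, map_add, hv, hv']
  | add t t' ht ht' => simp only [map_add, ht, ht']

/-- `a ⊗ (b ⊗ c) ↦ S(a) b ⊗ c`. -/
def antipodeMul (S : A →ₗ[K] A) : A ⊗[K] (A ⊗[K] A) →ₗ[K] A ⊗[K] A :=
  (LinearMap.mul' K A).rTensor A ∘ₗ (TensorProduct.assoc K A A A).symm.toLinearMap ∘ₗ
    S.rTensor (A ⊗[K] A)

theorem antipodeMul_tmul (S : A →ₗ[K] A) (a : A) (v : A ⊗[K] A) :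
    antipodeMul S (a ⊗ₜ[K] v) = (S a ⊗ₜ[K] (1 : A)) * v := by
  induction v with
  | zero => simp
  | tmul b c => simp [antipodeMul]
  | add v v' hv hv' => simp only [tmul_add, map_add, mul_add, hv, hv']

theorem antipodeMul_assoc_tmul (S : A →ₗ[K] A) (c : A) (v : A ⊗[K] A) :
    antipodeMul S (TensorProduct.assoc K A A A (v ⊗ₜ[K] c)) =
      LinearMap.mul' K A (S.rTensor A v) ⊗ₜ[K] c := by
  induction v with
  | zero => simp
  | tmul a b => simp [antipodeMul]
  | add v v' hv hv' => simp only [add_tmul, map_add, hv, hv']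

namespace WeakHopfAlgebra

variable {Δ : A →ₗ[K] A ⊗[K] A} {ε : A →ₗ[K] K} {S : A →ₗ[K] A}

theorem antipodeMul_comul (h : WeakHopfAlgebra K A Δ ε S) (x : A) :
    antipodeMul S (Δ.lTensor A (Δ x)) = ((1 : A) ⊗ₜ[K] x) * Δ 1 := by
  have key : ∀ t : A ⊗[K] A,
      antipodeMul S (TensorProduct.assoc K A A A (Δ.rTensor A t)) =
        (piR K A Δ ε).rTensor A t := by
    intro t
    induction t with
    | zero => simp
    | tmul a b =>
      rw [LinearMap.rTensor_tmul, antipodeMul_assoc_tmul, h.antipode_b, LinearMap.rTensor_tmul]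
    | add t t' ht ht' => simp only [map_add, ht, ht']
  rw [← h.toWeakBialgebra.coassoc, key, h.toWeakBialgebra.rTensor_piR_comul]

theorem mul'_map_antipode_piL (h : WeakHopfAlgebra K A Δ ε S) (x : A) :
    LinearMap.mul' K A (TensorProduct.map S (piL K A Δ ε) (Δ x)) = S x := by
  have hp : piL K A Δ ε = (LinearMap.mul' K A ∘ₗ S.lTensor A) ∘ₗ Δ := by
    ext x
    simp [h.antipode_a]
  rw [← h.antipode_c x, hp, ← LinearMap.map_comp_lTensor, LinearMap.comp_apply]

theorem tmul_one_mul_comul_integral (h : WeakHopfAlgebra K A Δ ε S) {l : A}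
    (hl : ∀ x : A, x * l = piL K A Δ ε x * l) (x : A) :
    ((1 : A) ⊗ₜ[K] x) * Δ l = (S x ⊗ₜ[K] (1 : A)) * Δ l := by
  have w := h.toWeakBialgebra
  have key : ∀ t : A ⊗[K] A, antipodeMul S (Δ.lTensor A t) * Δ l =
      (LinearMap.mul' K A (TensorProduct.map S (piL K A Δ ε) t) ⊗ₜ[K] (1 : A)) * Δ l := by
    intro t
    induction t with
    | zero => simp
    | tmul a b =>
      rw [LinearMap.lTensor_tmul, antipodeMul_tmul, mul_assoc, ← w.comul_mul, hl, w.comul_mul,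
        w.comul_piL_right, mul_assoc, w.comul_one_mul, ← mul_assoc]
      simp
    | add t t' ht ht' => simp only [map_add, add_mul, add_tmul, ht, ht']
  rw [← h.mul'_map_antipode_piL, ← key, h.antipodeMul_comul, mul_assoc, w.comul_one_mul]

theorem antipode_piL (h : WeakHopfAlgebra K A Δ ε S)
    (hmul : ∀ x y, S (x * y) = S y * S x) (x : A) :
    S (piL K A Δ ε x) = piR K A Δ ε (piL K A Δ ε x) := by
  have key : ∀ (z : A) (t : A ⊗[K] A),
      LinearMap.mul' K A (S.rTensor A (t * (z ⊗ₜ[K] (1 : A)))) =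
        S z * LinearMap.mul' K A (S.rTensor A t) := by
    intro z t
    induction t with
    | zero => simp
    | tmul a b => simp [hmul, mul_assoc]
    | add t t' ht ht' => simp only [map_add, add_mul, mul_add, ht, ht']
  rw [← h.antipode_b, h.toWeakBialgebra.comul_piL_left, key, h.antipode_b,
    h.toWeakBialgebra.piR_one, mul_one]

theorem antipode_piR (h : WeakHopfAlgebra K A Δ ε S)
    (hmul : ∀ x y, S (x * y) = S y * S x) (x : A) :
    S (piR K A Δ ε x) = piL K A Δ ε (piR K A Δ ε x) := by
  have key : ∀ (z : A) (t : A ⊗[K] A),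
      LinearMap.mul' K A (S.lTensor A (((1 : A) ⊗ₜ[K] z) * t)) =
        LinearMap.mul' K A (S.lTensor A t) * S z := by
    intro z t
    induction t with
    | zero => simp
    | tmul a b => simp [hmul, mul_assoc]
    | add t t' ht ht' => simp only [map_add, add_mul, mul_add, ht, ht']
  rw [← h.antipode_a, h.toWeakBialgebra.comul_piR, key, h.antipode_a,
    h.toWeakBialgebra.piL_one, one_mul]

theorem map_antipode_comm_comul_one (h : WeakHopfAlgebra K A Δ ε S)
    (hmul : ∀ x y, S (x * y) = S y * S x) :
    TensorProduct.map S S (TensorProduct.comm K A A (Δ 1)) = Δ 1 := by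
  have w := h.toWeakBialgebra
  have hE : TensorProduct.map (piR K A Δ ε) (piL K A Δ ε) (Δ 1) = Δ 1 := by
    rw [← LinearMap.lTensor_comp_rTensor, LinearMap.comp_apply, w.rTensor_piR_comul_one,
      w.lTensor_piL_comul_one]
  have key : ∀ t : A ⊗[K] A,
      TensorProduct.map S S (TensorProduct.comm K A A
        (TensorProduct.map (piR K A Δ ε) (piL K A Δ ε) t)) =
      TensorProduct.map (piR K A Δ ε) (piL K A Δ ε) (TensorProduct.comm K A A
        (TensorProduct.map (piR K A Δ ε) (piL K A Δ ε) t)) := by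
    intro t
    induction t with
    | zero => simp
    | tmul a b => simp [h.antipode_piL hmul, h.antipode_piR hmul]
    | add t t' ht ht' => simp only [map_add, ht, ht']
  have := key (Δ 1)
  rwa [hE, w.map_piR_piL_comm_comul_one] at this

section Integral

variable {l : A} {lam : A →ₗ[K] K}

theorem antipode_eq_sliceR (h : WeakHopfAlgebra K A Δ ε S)
    (hl : ∀ x : A, x * l = piL K A Δ ε x * l) (hlam : sliceR lam (Δ l) = 1) (x : A) :
    sliceR (lam ∘ₗ LinearMap.mulLeft K x) (Δ l) = S x := by
  rw [sliceR_comp_mulLeft, h.tmul_one_mul_comul_integral hl, sliceR_tmul_one_mul, hlam, mul_one]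

theorem antipode_mul (h : WeakHopfAlgebra K A Δ ε S)
    (hl : ∀ x : A, x * l = piL K A Δ ε x * l) (hlam : sliceR lam (Δ l) = 1) (x y : A) :
    S (x * y) = S y * S x := by
  have e : (S (x * y) ⊗ₜ[K] (1 : A)) * Δ l = ((S y * S x) ⊗ₜ[K] (1 : A)) * Δ l := by
    calc
      _ = ((1 : A) ⊗ₜ[K] x) * (((1 : A) ⊗ₜ[K] y) * Δ l) := by
        rw [← h.tmul_one_mul_comul_integral hl, ← mul_assoc]
        simp
      _ = (S y ⊗ₜ[K] (1 : A)) * (((1 : A) ⊗ₜ[K] x) * Δ l) := by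
        rw [h.tmul_one_mul_comul_integral hl y, ← mul_assoc, ← mul_assoc]
        simp
      _ = _ := by
        rw [h.tmul_one_mul_comul_integral hl x, ← mul_assoc]
        simp
  have := congrArg (sliceR lam) e
  rwa [sliceR_tmul_one_mul, sliceR_tmul_one_mul, hlam, mul_one, mul_one] at this

theorem antipode_injective (h : WeakHopfAlgebra K A Δ ε S)
    (hl : ∀ x : A, x * l = piL K A Δ ε x * l)
    (hnd : Function.Injective fun φ : A →ₗ[K] K => sliceR φ (Δ l)) :
    Function.Injective S := by
  rw [injective_iff_map_eq_zero]
  intro x hx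
  have h0 : ((1 : A) ⊗ₜ[K] x) * Δ l = 0 := by
    rw [h.tmul_one_mul_comul_integral hl, hx, zero_tmul, zero_mul]
  rw [← Module.forall_dual_apply_eq_zero_iff K]
  intro φ
  have h1 : φ ∘ₗ LinearMap.mulLeft K x = 0 := by
    apply hnd
    change sliceR _ _ = sliceR _ _
    rw [sliceR_comp_mulLeft, h0]
    simp [sliceR]
  simpa using LinearMap.congr_fun h1 1

variable [FiniteDimensional K A]

theorem exists_eq_comp_mulLeft (h : WeakHopfAlgebra K A Δ ε S)
    (hl : ∀ x : A, x * l = piL K A Δ ε x * l)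
    (hnd : Function.Injective fun φ : A →ₗ[K] K => sliceR φ (Δ l))
    (hlam : sliceR lam (Δ l) = 1) (φ : A →ₗ[K] K) :
    ∃ x, φ = lam ∘ₗ LinearMap.mulLeft K x := by
  let f : A →ₗ[K] Module.Dual K A := (LinearMap.mul K A).compr₂ lam
  have hf : ∀ x, f x = lam ∘ₗ LinearMap.mulLeft K x := fun x => rfl
  have hinj : Function.Injective f := by
    rw [injective_iff_map_eq_zero]
    intro x hx
    apply h.antipode_injective hl hnd
    rw [map_zero, ← h.antipode_eq_sliceR hl hlam x, ← hf, hx]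
    simp [sliceR]
  obtain ⟨x, hx⟩ := (LinearMap.injective_iff_surjective_of_finrank_eq_finrank
    Subspace.dual_finrank_eq.symm).1 hinj φ
  exact ⟨x, hx ▸ hf x⟩

theorem eq_of_forall_mul_left (h : WeakHopfAlgebra K A Δ ε S)
    (hl : ∀ x : A, x * l = piL K A Δ ε x * l)
    (hnd : Function.Injective fun φ : A →ₗ[K] K => sliceR φ (Δ l))
    (hlam : sliceR lam (Δ l) = 1) {y z : A} (hyz : ∀ x, lam (x * y) = lam (x * z)) :
    y = z := by
  rw [← sub_eq_zero, ← Module.forall_dual_apply_eq_zero_iff K]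
  intro φ
  obtain ⟨x, rfl⟩ := h.exists_eq_comp_mulLeft hl hnd hlam φ
  simp [mul_sub, hyz]

theorem sliceL_comp_leftInverse (h : WeakHopfAlgebra K A Δ ε S)
    (hl : ∀ x : A, x * l = piL K A Δ ε x * l)
    (hnd : Function.Injective fun φ : A →ₗ[K] K => sliceR φ (Δ l))
    (hlam : sliceR lam (Δ l) = 1) {T : A →ₗ[K] A} (hT : ∀ x, T (S x) = x) (y : A) :
    sliceL (lam ∘ₗ LinearMap.mulRight K y ∘ₗ T) (Δ l) = y := by
  refine h.eq_of_forall_mul_left hl hnd hlam fun x => ?_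
  have := apply_sliceL_eq_apply_sliceR (lam ∘ₗ LinearMap.mulLeft K x)
    (lam ∘ₗ LinearMap.mulRight K y ∘ₗ T) (Δ l)
  rw [h.antipode_eq_sliceR hl hlam] at this
  simpa [hT] using this

theorem sliceR_comul (h : WeakHopfAlgebra K A Δ ε S)
    (hl : ∀ x : A, x * l = piL K A Δ ε x * l)
    (hnd : Function.Injective fun φ : A →ₗ[K] K => sliceR φ (Δ l))
    (hlam : sliceR lam (Δ l) = 1) (y : A) :
    sliceR lam (Δ y) = sliceR (lam ∘ₗ LinearMap.mulRight K y) (S.rTensor A (Δ 1)) := by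
  obtain ⟨T, hT⟩ := LinearMap.exists_leftInverse_of_injective S
    (LinearMap.ker_eq_bot.2 (h.antipode_injective hl hnd))
  replace hT : ∀ x, T (S x) = x := fun x => LinearMap.congr_fun hT x
  have h1 : (sliceR lam ∘ₗ Δ).lTensor A (Δ l) = Δ 1 := by
    rw [LinearMap.lTensor_comp, LinearMap.comp_apply, ← h.toWeakBialgebra.coassoc,
      lTensor_sliceR_assoc, ← map_sliceR, hlam]
  have key : ∀ t : A ⊗[K] A,
      sliceL (lam ∘ₗ LinearMap.mulRight K y ∘ₗ T)
        (TensorProduct.map S S (TensorProduct.comm K A A t)) =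
      sliceR (lam ∘ₗ LinearMap.mulRight K y) (S.rTensor A t) := by
    intro t
    induction t with
    | zero => simp
    | tmul a b => simp [hT]
    | add t t' ht ht' => simp only [map_add, ht, ht']
  rw [← key, h.map_antipode_comm_comul_one (h.antipode_mul hl hlam), ← h1, ← map_sliceL,
    h.sliceL_comp_leftInverse hl hnd hlam hT, LinearMap.comp_apply]

theorem sliceR_rTensor_antipode (h : WeakHopfAlgebra K A Δ ε S)
    (hl : ∀ x : A, x * l = piL K A Δ ε x * l)
    (hnd : Function.Injective fun φ : A →ₗ[K] K => sliceR φ (Δ l))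
    (hlam : sliceR lam (Δ l) = 1) (x y : A) :
    sliceR (lam ∘ₗ LinearMap.mulRight K y) (S.rTensor A (Δ x)) =
      sliceR (lam ∘ₗ LinearMap.mulLeft K x) (Δ y) := by
  have w := h.toWeakBialgebra
  have aux : ∀ (a b : A) (s : A ⊗[K] A),
      S a * sliceR (lam ∘ₗ LinearMap.mulRight K (b * y)) (S.rTensor A s) =
        sliceR (lam ∘ₗ LinearMap.mulRight K y) (S.rTensor A (s * (a ⊗ₜ[K] b))) := by
    intro a b s
    induction s with
    | zero => simp
    | tmul p q => simp [h.antipode_mul hl hlam, mul_assoc]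
    | add t t' ht ht' => simp only [map_add, add_mul, mul_add, ht, ht']
  have key : ∀ t : A ⊗[K] A, sliceR lam (antipodeMul S (Δ.lTensor A t) * Δ y) =
      sliceR (lam ∘ₗ LinearMap.mulRight K y) (S.rTensor A (Δ 1 * t)) := by
    intro t
    induction t with
    | zero => simp
    | tmul a b =>
      rw [LinearMap.lTensor_tmul, antipodeMul_tmul, mul_assoc, ← w.comul_mul,
        sliceR_tmul_one_mul, h.sliceR_comul hl hnd hlam, aux]
    | add t t' ht ht' => simp only [map_add, add_mul, mul_add, ht, ht']
  rw [sliceR_comp_mulLeft, ← w.comul_one_mul x, ← key, h.antipodeMul_comul, mul_assoc,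
    w.comul_one_mul]

theorem comul_antipode (h : WeakHopfAlgebra K A Δ ε S)
    (hl : ∀ x : A, x * l = piL K A Δ ε x * l)
    (hnd : Function.Injective fun φ : A →ₗ[K] K => sliceR φ (Δ l))
    (hlam : sliceR lam (Δ l) = 1) (x : A) :
    Δ (S x) = TensorProduct.map S S (TensorProduct.comm K A A (Δ x)) := by
  have key : ∀ s t : A ⊗[K] A, ∀ f : A →ₗ[K] A,
      (∀ y, f y = sliceR (lam ∘ₗ LinearMap.mulRight K y) (S.rTensor A s)) →
      f.lTensor A t =
        TensorProduct.map ((sliceR lam ∘ₗ LinearMap.mulRight K t) ∘ₗ TensorProduct.mk K A A 1) S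
          (TensorProduct.comm K A A s) := by
    intro s t f hf
    induction t with
    | zero =>
      rw [map_zero, LinearMap.mulRight_zero_eq_zero]
      simp
    | tmul p q =>
      rw [LinearMap.lTensor_tmul, hf]
      clear hf
      induction s with
      | zero => simp
      | tmul c d => simp [smul_tmul]
      | add u u' hu hu' => simp only [map_add, tmul_add, hu, hu']
    | add t t' ht ht' =>
      rw [map_add, ht, ht', ← LinearMap.add_apply, ← TensorProduct.map_add_left]
      congr 2
      ext
      simp [mul_add]
  have hS : (sliceR lam ∘ₗ LinearMap.mulRight K (Δ l)) ∘ₗ TensorProduct.mk K A A 1 = S := by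
    ext x
    rw [← h.antipode_eq_sliceR hl hlam x, sliceR_comp_mulLeft]
    simp
  have hk := key (Δ x) (Δ l) (sliceR (lam ∘ₗ LinearMap.mulLeft K x) ∘ₗ Δ) fun y => by
    rw [h.sliceR_rTensor_antipode hl hnd hlam, LinearMap.comp_apply]
  rw [hS] at hk
  rw [← hk, ← h.antipode_eq_sliceR hl hlam x, map_sliceR, ← lTensor_sliceR_assoc,
    h.toWeakBialgebra.coassoc, ← LinearMap.comp_apply, ← LinearMap.lTensor_comp]

theorem antipode_integral_eq_iff (h : WeakHopfAlgebra K A Δ ε S)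
    (hl : ∀ x : A, x * l = piL K A Δ ε x * l)
    (hnd : Function.Bijective fun φ : A →ₗ[K] K => sliceR φ (Δ l))
    (hlam : sliceR lam (Δ l) = 1) :
    S l = l ↔ ∀ x y : A, lam (x * y) = lam (y * S (S x)) := by
  have hi := hnd.injective
  have hSi := h.antipode_injective hl hi
  obtain ⟨T, hT⟩ := LinearMap.exists_leftInverse_of_injective S (LinearMap.ker_eq_bot.2 hSi)
  replace hT : ∀ x, T (S x) = x := fun x => LinearMap.congr_fun hT x
  have hTS : ∀ x, S (T x) = x := fun x => by
    obtain ⟨y, rfl⟩ := LinearMap.injective_iff_surjective.1 hSi x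
    rw [hT]
  have hdual := h.sliceL_comp_leftInverse hl hi hlam hT
  have key : ∀ (y : A) (t : A ⊗[K] A),
      sliceR (lam ∘ₗ LinearMap.mulLeft K y)
        (TensorProduct.map S S (TensorProduct.comm K A A t)) =
      S (sliceL (lam ∘ₗ LinearMap.mulLeft K y ∘ₗ S) t) := by
    intro y t
    induction t with
    | zero => simp
    | tmul a b => simp
    | add t t' ht ht' => simp only [map_add, ht, ht']
  constructor
  · intro hSl x y
    have h1 : sliceL (lam ∘ₗ LinearMap.mulLeft K y ∘ₗ S) (Δ l) = y := by
      apply hSi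
      rw [← key, ← h.comul_antipode hl hi hlam, hSl, h.antipode_eq_sliceR hl hlam]
    obtain ⟨φ, hφ⟩ := hnd.surjective (S x)
    replace hφ : sliceR φ (Δ l) = S x := hφ
    have h2 := apply_sliceL_eq_apply_sliceR φ (lam ∘ₗ LinearMap.mulLeft K y ∘ₗ S) (Δ l)
    have h3 := apply_sliceL_eq_apply_sliceR φ (lam ∘ₗ LinearMap.mulRight K y ∘ₗ T) (Δ l)
    rw [h1, hφ] at h2
    rw [hdual, hφ, h2] at h3
    simpa [hT] using h3.symm
  · intro htr
    obtain ⟨y, hy⟩ := h.exists_eq_comp_mulLeft hl hi hlam ε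
    have hST : lam ∘ₗ LinearMap.mulLeft K y ∘ₗ S = lam ∘ₗ LinearMap.mulRight K y ∘ₗ T := by
      ext a
      simpa [hTS] using (htr (T a) y).symm
    rw [← h.toWeakBialgebra.sliceR_counit (S l), hy, h.comul_antipode hl hi hlam, key, hST, hdual,
      ← h.antipode_eq_sliceR hl hlam, ← hy, h.toWeakBialgebra.sliceR_counit]

end Integral

end WeakHopfAlgebra

end WeakHopf

/-- Let `l` be a nondegenerate left integral in a weak Hopf algebra `A`
and let `λ` be its dual left integral (the unique functional with `Σ l₍₁₎ λ(l₍₂₎) = 1`).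
Then `S(l) = l` if and only if `λ` is a q-trace, i.e. `λ(xy) = λ(y S²(x))` for all `x, y`. -/
theorem weakHopfAlgebra_S_invariant_iff_qtrace
    (K : Type*) [Field K] (A : Type*) [Ring A] [Algebra K A] [FiniteDimensional K A]
    (Δ : A →ₗ[K] A ⊗[K] A) (ε : A →ₗ[K] K) (S : A →ₗ[K] A)
    (hA : WeakHopfAlgebra K A Δ ε S)
    (l : A) (hl : ∀ x : A, x * l = piL K A Δ ε x * l)
    (hnd : Function.Bijective
      (fun φ : A →ₗ[K] K => (TensorProduct.rid K A) (LinearMap.lTensor A φ (Δ l))))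
    (lam : A →ₗ[K] K)
    (hlam : (TensorProduct.rid K A) (LinearMap.lTensor A lam (Δ l)) = 1) :
    S l = l ↔ ∀ x y : A, lam (x * y) = lam (y * S (S x)) := by
  exact hA.antipode_integral_eq_iff hl hnd hlam
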